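/- arXiv:1907.01241 — 2 statements merged into one kernel-verified Lean document; each statement's English description precedes it below -/
import Mathlib

section
/- For every dimension d ≥ 3 and every natural number n, there exists a family of n pairwise disjoint convex sets in ℝ^d that is shattered by halfspaces. Consequently, the VC-dimension of halfspaces with respect to pairwise disjoint convex sets in ℝ^d, d ≥ 3, is unbounded. -/
open RealInnerProductSpace

/-- A (closed) halfspace in `ℝ^d`: `{x | ⟪a, x⟫ ≤ b}` for some nonzero `a` and real `b`. -/
def IsHalfspace {d : ℕ} (h : Set (EuclideanSpace ℝ (Fin d))) : Prop :=
  ∃ a : EuclideanSpace ℝ (Fin d), a ≠ 0 ∧ ∃ b : ℝ,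
    h = {x : EuclideanSpace ℝ (Fin d) | ⟪a, x⟫ ≤ b}

/-- A family of sets in `ℝ^d` is shattered by halfspaces if every subfamily is
realized by some halfspace. -/
def ShatteredByHalfspaces {d : ℕ} {ι : Type} (C : ι → Set (EuclideanSpace ℝ (Fin d))) : Prop :=
  ∀ T : Set ι, ∃ h : Set (EuclideanSpace ℝ (Fin d)),
    IsHalfspace h ∧ ∀ i : ι, C i ⊆ h ↔ i ∈ T

/-- The point `(t, t², z, 0, …, 0)` of the parabola at height `z`. -/
noncomputable def parabolaPoint (k : ℕ) (t z : ℝ) : EuclideanSpace ℝ (Fin (k + 3)) :=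
  EuclideanSpace.single 0 t + EuclideanSpace.single 1 (t ^ 2) + EuclideanSpace.single 2 z

/-- A normal vector of the halfspaces cutting the parabola near the parameter `t`. -/
noncomputable def parabolaNormal (k : ℕ) (t : ℝ) : EuclideanSpace ℝ (Fin (k + 3)) :=
  EuclideanSpace.single 0 (2 * t) - EuclideanSpace.single 1 1

lemma parabolaPoint_apply_two (k : ℕ) (t z : ℝ) : parabolaPoint k t z 2 = z := by
  have h0 : (2 : Fin (k + 3)) ≠ 0 := by
    simp [Fin.ext_iff, Nat.mod_eq_of_lt (show 2 < k + 3 by omega)]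
  have h1 : (2 : Fin (k + 3)) ≠ 1 := by
    simp [Fin.ext_iff, Nat.mod_eq_of_lt (show 2 < k + 3 by omega)]
  simp [parabolaPoint, h0, h1]

lemma parabolaNormal_ne_zero (k : ℕ) (t : ℝ) : parabolaNormal k t ≠ 0 := by
  intro h
  have := congrArg (fun v : EuclideanSpace ℝ (Fin (k + 3)) => v 1) h
  simp [parabolaNormal] at this

lemma inner_parabolaNormal_parabolaPoint (k : ℕ) (t s z : ℝ) :
    ⟪parabolaNormal k t, parabolaPoint k s z⟫ = t ^ 2 - (s - t) ^ 2 := by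
  have h0 : (0 : Fin (k + 3)) ≠ 2 := by
    simp [Fin.ext_iff, Nat.mod_eq_of_lt (show 2 < k + 3 by omega)]
  have h1 : (1 : Fin (k + 3)) ≠ 2 := by
    simp [Fin.ext_iff, Nat.mod_eq_of_lt (show 2 < k + 3 by omega)]
  simp [parabolaNormal, parabolaPoint, inner_sub_left, EuclideanSpace.inner_single_left, h0, h1]
  ring

lemma convex_setOf_apply_eq {d : ℕ} (j : Fin d) (z : ℝ) :
    Convex ℝ {x : EuclideanSpace ℝ (Fin d) | x j = z} :=
  convex_hyperplane (f := fun x : EuclideanSpace ℝ (Fin d) => x j)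
    ⟨fun _ _ => rfl, fun _ _ => rfl⟩ z

lemma convex_setOf_inner_le {d : ℕ} (a : EuclideanSpace ℝ (Fin d)) (b : ℝ) :
    Convex ℝ {x : EuclideanSpace ℝ (Fin d) | ⟪a, x⟫ ≤ b} :=
  convex_halfSpace_le (innerSL ℝ a).toLinearMap.isLinear b

lemma one_le_sq_natCast_sub {s t : ℕ} (h : s ≠ t) : (1 : ℝ) ≤ ((s : ℝ) - t) ^ 2 := by
  have h' : (0 : ℤ) < ((s : ℤ) - t) ^ 2 := by
    have : (s : ℤ) - t ≠ 0 := by omega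
    positivity
  exact_mod_cast Int.add_one_le_of_lt h'

/-- For every `d ≥ 3` and every `n`, there is a family of `n` pairwise disjoint convex
sets in `ℝ^d` that is shattered by halfspaces. -/
theorem unbounded_VC_disjoint_convex_sets_higher_dim (d : ℕ) (hd : 3 ≤ d) (n : ℕ) :
    ∃ C : Fin n → Set (EuclideanSpace ℝ (Fin d)),
      (∀ i, Convex ℝ (C i)) ∧
      (∀ i j, i ≠ j → Disjoint (C i) (C j)) ∧
      ShatteredByHalfspaces C := by
  obtain ⟨k, rfl⟩ := Nat.exists_eq_add_of_le' hd
  obtain ⟨f, hf⟩ := exists_injective_nat (Set (Fin n))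
  let P : Fin n → Set (EuclideanSpace ℝ (Fin (k + 3))) :=
    fun i => {x | ∃ T : Set (Fin n), i ∉ T ∧ parabolaPoint k (f T) (i : ℕ) = x}
  have hheight : ∀ i, convexHull ℝ (P i) ⊆ {x | x 2 = ((i : ℕ) : ℝ)} := by
    refine fun i => convexHull_min ?_ (convex_setOf_apply_eq 2 _)
    rintro _ ⟨T, -, rfl⟩
    exact parabolaPoint_apply_two k _ _
  refine ⟨fun i => convexHull ℝ (P i), fun i => convex_convexHull ℝ _, ?_, ?_⟩
  · refine fun i j hij => Set.disjoint_left.mpr fun x hi hj => hij (Fin.ext ?_)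
    have h : ((i : ℕ) : ℝ) = ((j : ℕ) : ℝ) := (hheight i hi).symm.trans (hheight j hj)
    exact_mod_cast h
  · intro T
    refine ⟨_, ⟨parabolaNormal k (f T), parabolaNormal_ne_zero k _, (f T : ℝ) ^ 2 - 1, rfl⟩,
      fun i => ⟨fun h => ?_, fun hi => ?_⟩⟩
    · by_contra hi
      have hle := h (subset_convexHull ℝ (P i) ⟨T, hi, rfl⟩)
      rw [Set.mem_ofPred_eq, inner_parabolaNormal_parabolaPoint] at hle
      norm_num at hle
    · refine convexHull_min ?_ (convex_setOf_inner_le _ _)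
      rintro _ ⟨S, hS, rfl⟩
      have hne : f S ≠ f T := hf.ne (by rintro rfl; exact hS hi)
      rw [Set.mem_ofPred_eq, inner_parabolaNormal_parabolaPoint]
      linarith [one_le_sq_natCast_sub hne]
end

section
/- No family of six line segments in the plane ℝ², in general position (no three endpoints collinear), is shattered by halfplanes: since at most 2·6·5 + 2 = 62 < 2⁶ = 64 subsets can be realized, some subset is not realized. -/
open RealInnerProductSpace

/-- The Euclidean plane `ℝ²`. -/
abbrev Plane : Type := EuclideanSpace ℝ (Fin 2)

/-- A (closed) halfplane: `{x | ⟪a, x⟫ ≤ b}` for some nonzero `a` and real `b`. -/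
def IsHalfplane (h : Set Plane) : Prop :=
  ∃ a : Plane, a ≠ 0 ∧ ∃ b : ℝ, h = {x : Plane | ⟪a, x⟫ ≤ b}

/-- A family of sets in the plane is shattered by halfplanes if every subfamily is
realized by some halfplane. -/
def ShatteredByHalfplanes {ι : Type} (C : ι → Set Plane) : Prop :=
  ∀ T : Set ι, ∃ h : Set Plane, IsHalfplane h ∧ ∀ i : ι, C i ⊆ h ↔ i ∈ T

/-- The endpoints of an indexed family of segments (given by their endpoint pairs):
the endpoint of segment `x.1` selected by `x.2`. -/
def endpointOf {n : ℕ} (s : Fin n → Plane × Plane) (x : Fin n × Bool) : Plane :=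
  if x.2 then (s x.1).2 else (s x.1).1

/-- A family of segments is in general position if no three of its `2n` endpoints are
collinear. -/
def InGeneralPosition {n : ℕ} (s : Fin n → Plane × Plane) : Prop :=
  ∀ x y z : Fin n × Bool, x ≠ y → x ≠ z → y ≠ z →
    ¬ Collinear ℝ ({endpointOf s x, endpointOf s y, endpointOf s z} : Set Plane)

/-- The value at `p` of the linear functional with unit normal `(cos t, sin t)`. -/
noncomputable def dirVal (p : Plane) (t : ℝ) : ℝ := p 0 * Real.cos t + p 1 * Real.sin t

/-- The derivative of `dirVal p` at the angle `t`. -/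
noncomputable def dirDeriv (p : Plane) (t : ℝ) : ℝ := p 1 * Real.cos t - p 0 * Real.sin t

/-- The support function of the `i`-th segment at the angle `t`. -/
noncomputable def supportVal {n : ℕ} (s : Fin n → Plane × Plane) (i : Fin n) (t : ℝ) : ℝ :=
  max (dirVal (s i).1 t) (dirVal (s i).2 t)

theorem continuous_dirVal (p : Plane) : Continuous (dirVal p) := by
  unfold dirVal
  fun_prop

theorem continuous_supportVal {n : ℕ} (s : Fin n → Plane × Plane) (i : Fin n) :
    Continuous (supportVal s i) :=
  (continuous_dirVal _).max (continuous_dirVal _)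

theorem dirVal_le_supportVal {n : ℕ} (s : Fin n → Plane × Plane) (x : Fin n × Bool) (t : ℝ) :
    dirVal (endpointOf s x) t ≤ supportVal s x.1 t := by
  obtain ⟨i, b⟩ := x
  cases b <;> simp [endpointOf, supportVal]

theorem exists_supportVal_eq {n : ℕ} (s : Fin n → Plane × Plane) (i : Fin n) (t : ℝ) :
    ∃ x : Fin n × Bool, x.1 = i ∧ supportVal s x.1 t = dirVal (endpointOf s x) t := by
  rcases max_choice (dirVal (s i).1 t) (dirVal (s i).2 t) with h | h
  · exact ⟨(i, false), rfl, by simpa [endpointOf, supportVal] using h⟩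
  · exact ⟨(i, true), rfl, by simpa [endpointOf, supportVal] using h⟩

theorem supportVal_eq_max_not {n : ℕ} (s : Fin n → Plane × Plane) (x : Fin n × Bool) (t : ℝ) :
    supportVal s x.1 t =
      max (dirVal (endpointOf s x) t) (dirVal (endpointOf s (x.1, !x.2)) t) := by
  obtain ⟨i, b⟩ := x
  cases b
  · simp [endpointOf, supportVal]
  · simp [endpointOf, supportVal, max_comm]

theorem ne_mk_fst_not_snd {α : Type*} (x : α × Bool) : x ≠ (x.1, !x.2) := by
  obtain ⟨i, b⟩ := x
  cases b <;> simp

theorem collinear_of_dirVal_eq {p q r : Plane} {t : ℝ} (hq : dirVal p t = dirVal q t)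
    (hr : dirVal p t = dirVal r t) : Collinear ℝ ({p, q, r} : Set Plane) := by
  have key : ∀ z : Plane, dirVal p t = dirVal z t →
      ∃ c : ℝ, z = c • (!₂[-Real.sin t, Real.cos t] : Plane) +ᵥ p := by
    intro z hz
    refine ⟨dirDeriv z t - dirDeriv p t, ?_⟩
    have hsc := Real.sin_sq_add_cos_sq t
    unfold dirVal at hz
    unfold dirDeriv
    ext k
    fin_cases k
    · simp
      linear_combination (p 0 - z 0) * hsc - Real.cos t * hz
    · simp
      linear_combination (p 1 - z 1) * hsc - Real.sin t * hz
  rw [collinear_iff_of_mem (p₀ := p) (by simp)]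
  refine ⟨!₂[-Real.sin t, Real.cos t], ?_⟩
  rintro z (rfl | rfl | rfl)
  · exact key _ rfl
  · exact key _ hq
  · exact key _ hr

theorem InGeneralPosition.dirVal_ne {n : ℕ} {s : Fin n → Plane × Plane}
    (hgp : InGeneralPosition s) {x y z : Fin n × Bool} {t : ℝ} (hxy : x ≠ y) (hxz : x ≠ z)
    (hyz : y ≠ z) (h : dirVal (endpointOf s x) t = dirVal (endpointOf s y) t) :
    dirVal (endpointOf s x) t ≠ dirVal (endpointOf s z) t :=
  fun h' => hgp x y z hxy hxz hyz (collinear_of_dirVal_eq h h')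

/-- The segments of `T` and those outside `T` are touched by a common supporting line, in the
endpoints `x` and `y`, and `T` is about to stop being realized as the normal direction rotates
counterclockwise through `t`. -/
structure IsTransition {n : ℕ} (s : Fin n → Plane × Plane) (T : Set (Fin n))
    (x y : Fin n × Bool) (t : ℝ) : Prop where
  mem : x.1 ∈ T
  notMem : y.1 ∉ T
  dirVal_eq : dirVal (endpointOf s x) t = dirVal (endpointOf s y) t
  flip_left_lt : dirVal (endpointOf s (x.1, !x.2)) t < dirVal (endpointOf s x) t
  flip_right_lt : dirVal (endpointOf s (y.1, !y.2)) t < dirVal (endpointOf s y) t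
  lt_of_mem : ∀ i ∈ T, i ≠ x.1 → supportVal s i t < dirVal (endpointOf s x) t
  le_of_notMem : ∀ i ∉ T, dirVal (endpointOf s x) t ≤ supportVal s i t
  dirDeriv_lt : dirDeriv (endpointOf s y) t < dirDeriv (endpointOf s x) t

theorem dirVal_eq_rotate (p : Plane) (t u : ℝ) :
    dirVal p u = dirVal p t * Real.cos (u - t) + dirDeriv p t * Real.sin (u - t) := by
  have hsc := Real.sin_sq_add_cos_sq t
  rw [Real.cos_sub, Real.sin_sub]
  unfold dirVal dirDeriv
  linear_combination (-p 0 * Real.cos u - p 1 * Real.sin u) * hsc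

theorem dirDeriv_lt_of_dirVal_lt {p q : Plane} {t u : ℝ} (hu : u < t) (hut : t - u < Real.pi)
    (h : dirVal p t = dirVal q t) (hlt : dirVal p u < dirVal q u) :
    dirDeriv q t < dirDeriv p t := by
  rw [dirVal_eq_rotate p t u, dirVal_eq_rotate q t u, h] at hlt
  have hs : Real.sin (u - t) < 0 := Real.sin_neg_of_neg_of_neg_pi_lt (by linarith) (by linarith)
  nlinarith

theorem sin_cos_sub_of_common_tangent {p q r : Plane} {t u : ℝ} (ht : dirVal p t = dirVal q t)
    (hu : dirVal p u = dirVal q u) (hne : dirDeriv q t ≠ dirDeriv p t)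
    (hrt : dirVal r t < dirVal p t) (hru : dirVal r u < dirVal p u) :
    Real.sin (u - t) = 0 ∧ Real.cos (u - t) = 1 := by
  have hp := dirVal_eq_rotate p t u
  have hq := dirVal_eq_rotate q t u
  have hr := dirVal_eq_rotate r t u
  have hs : Real.sin (u - t) = 0 := by
    have : (dirDeriv q t - dirDeriv p t) * Real.sin (u - t) = 0 := by
      linear_combination hp - hq - hu + Real.cos (u - t) * ht
    exact (mul_eq_zero.mp this).resolve_left (sub_ne_zero.mpr hne)
  refine ⟨hs, ?_⟩
  rcases Real.sin_eq_zero_iff_cos_eq.mp hs with h | h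
  · exact h
  · rw [hs, h] at hp hr
    linarith

theorem IsTransition.dirVal_eq_and_dirDeriv_eq {n : ℕ} {s : Fin n → Plane × Plane}
    {T : Set (Fin n)} {x y z : Fin n × Bool} {t u : ℝ} (h : IsTransition s T x y t)
    (hu : dirVal (endpointOf s x) u = dirVal (endpointOf s y) u)
    (hz : dirVal (endpointOf s z) t < dirVal (endpointOf s x) t)
    (hzu : dirVal (endpointOf s z) u < dirVal (endpointOf s x) u) (p : Plane) :
    dirVal p u = dirVal p t ∧ dirDeriv p u = dirDeriv p t := by
  obtain ⟨hs, hc⟩ := sin_cos_sub_of_common_tangent h.dirVal_eq hu h.dirDeriv_lt.ne hz hzu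
  have hu' : u = (u - t) + t := by ring
  constructor
  · rw [dirVal_eq_rotate p t u, hs, hc]; ring
  · rw [dirDeriv, dirDeriv, hu', Real.cos_add, Real.sin_add, hs, hc]; ring

theorem IsTransition.subset {n : ℕ} {s : Fin n → Plane × Plane} {T T' : Set (Fin n)}
    {x y : Fin n × Bool} {t u : ℝ} (h : IsTransition s T x y t) (h' : IsTransition s T' x y u) :
    T ⊆ T' := by
  have key := h.dirVal_eq_and_dirDeriv_eq h'.dirVal_eq h.flip_left_lt h'.flip_left_lt
  intro i hi
  by_contra hi'
  have hne : i ≠ x.1 := fun e => hi' (e ▸ h'.mem)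
  have h1 := h.lt_of_mem i hi hne
  have h2 := h'.le_of_notMem i hi'
  simp only [supportVal, (key _).1] at h1 h2
  linarith

theorem IsTransition.eq {n : ℕ} {s : Fin n → Plane × Plane} {T T' : Set (Fin n)}
    {x y : Fin n × Bool} {t u : ℝ} (h : IsTransition s T x y t) (h' : IsTransition s T' x y u) :
    T = T' :=
  (h.subset h').antisymm (h'.subset h)

theorem IsTransition.not_swap {n : ℕ} {s : Fin n → Plane × Plane} {T T' : Set (Fin n)}
    {x y : Fin n × Bool} {t u : ℝ} (h : IsTransition s T x y t) : ¬ IsTransition s T' y x u := by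
  intro h'
  have key := h.dirVal_eq_and_dirDeriv_eq h'.dirVal_eq.symm h.flip_left_lt h'.flip_right_lt
  have hlt := h'.dirDeriv_lt
  rw [(key _).2, (key _).2] at hlt
  exact hlt.not_gt h.dirDeriv_lt

theorem exists_angle {a : Plane} (ha : a ≠ 0) :
    ∃ r : ℝ, 0 < r ∧ ∃ t : ℝ, ∀ p : Plane, ⟪a, p⟫ = r * dirVal p t := by
  set z : ℂ := ⟨a 0, a 1⟩ with hz
  have hz0 : z ≠ 0 := by
    intro h
    apply ha
    ext k
    fin_cases k
    · simpa [hz] using congrArg Complex.re h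
    · simpa [hz] using congrArg Complex.im h
  refine ⟨‖z‖, norm_pos_iff.mpr hz0, z.arg, fun p => ?_⟩
  have h0 : ‖z‖ * Real.cos z.arg = a 0 := Complex.norm_mul_cos_arg z
  have h1 : ‖z‖ * Real.sin z.arg = a 1 := Complex.norm_mul_sin_arg z
  rw [dirVal, PiLp.inner_apply, Fin.sum_univ_two]
  simp only [RCLike.inner_apply, conj_trivial]
  linear_combination - p 0 * h0 - p 1 * h1

theorem segment_subset_halfplane_iff (a p q : Plane) (b : ℝ) :
    segment ℝ p q ⊆ {x : Plane | ⟪a, x⟫ ≤ b} ↔ ⟪a, p⟫ ≤ b ∧ ⟪a, q⟫ ≤ b := by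
  constructor
  · exact fun h => ⟨h (left_mem_segment ℝ p q), h (right_mem_segment ℝ p q)⟩
  · rintro ⟨hp, hq⟩
    exact (convex_halfSpace_le (innerₛₗ ℝ a).isLinear b).segment_subset hp hq

theorem ShatteredByHalfplanes.exists_supportVal_le_iff {n : ℕ} {s : Fin n → Plane × Plane}
    (hs : ShatteredByHalfplanes (fun i => segment ℝ (s i).1 (s i).2)) (T : Set (Fin n)) :
    ∃ t b : ℝ, ∀ i, supportVal s i t ≤ b ↔ i ∈ T := by
  obtain ⟨h, ⟨a, ha, b, rfl⟩, hT⟩ := hs T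
  obtain ⟨r, hr, t, hrt⟩ := exists_angle ha
  refine ⟨t, b / r, fun i => ?_⟩
  rw [← hT i, segment_subset_halfplane_iff, hrt, hrt, supportVal, max_le_iff, le_div_iff₀' hr,
    le_div_iff₀' hr]

theorem dirVal_add_int_mul_two_pi (p : Plane) (t : ℝ) (k : ℤ) :
    dirVal p (t + k * (2 * Real.pi)) = dirVal p t := by
  rw [dirVal, Real.cos_add_int_mul_two_pi, Real.sin_add_int_mul_two_pi, dirVal]

theorem exists_supportVal_lt_of_shattered {n : ℕ} {s : Fin n → Plane × Plane}
    (hs : ShatteredByHalfplanes (fun i => segment ℝ (s i).1 (s i).2)) {i j : Fin n} (hij : i ≠ j)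
    (t₀ : ℝ) : ∃ t, t₀ ≤ t ∧ supportVal s j t < supportVal s i t := by
  obtain ⟨t, b, h⟩ := hs.exists_supportVal_le_iff {j}
  obtain ⟨k, hk⟩ := exists_int_gt ((t₀ - t) / (2 * Real.pi))
  rw [div_lt_iff₀ Real.two_pi_pos] at hk
  refine ⟨t + k * (2 * Real.pi), by linarith, ?_⟩
  have h1 := (h j).2 rfl
  have h2 := mt (h i).1 hij
  simp only [supportVal, dirVal_add_int_mul_two_pi] at h1 h2 ⊢
  linarith

/-- Rotating a halfplane that realizes `T` counterclockwise until `T` is about to be lost. -/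
theorem exists_last_angle {n : ℕ} {s : Fin n → Plane × Plane}
    (hs : ShatteredByHalfplanes (fun i => segment ℝ (s i).1 (s i).2)) {T : Set (Fin n)}
    (hT : T.Nonempty) (hT' : Tᶜ.Nonempty) :
    ∃ t₀ t, t₀ < t ∧
      (∀ u ∈ Set.Ico t₀ t, ∀ i ∈ T, ∀ j ∉ T, supportVal s i u < supportVal s j u) ∧
      ∃ i ∈ T, ∃ j ∉ T, supportVal s j t ≤ supportVal s i t := by
  obtain ⟨t₀, b, hb⟩ := hs.exists_supportVal_le_iff T
  obtain ⟨i, hi⟩ := hT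
  obtain ⟨j, hj⟩ := hT'
  obtain ⟨t₁, ht₁, hlt⟩ := exists_supportVal_lt_of_shattered hs (ne_of_mem_of_not_mem hi hj) t₀
  set A : Set ℝ := {t | ∃ i ∈ T, ∃ j ∈ Tᶜ, supportVal s j t ≤ supportVal s i t} with hA
  have hAc : IsClosed A := by
    have : A = ⋃ i ∈ T, ⋃ j ∈ Tᶜ, {t | supportVal s j t ≤ supportVal s i t} := by
      ext t
      simp [hA]
    rw [this]
    exact T.toFinite.isClosed_biUnion fun i _ => Tᶜ.toFinite.isClosed_biUnion fun j _ =>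
      isClosed_le (continuous_supportVal s j) (continuous_supportVal s i)
  obtain ⟨t, ⟨htI, htA⟩, hmin⟩ := (isCompact_Icc.inter_right hAc).exists_isLeast
    (s := Set.Icc t₀ t₁ ∩ A) ⟨t₁, ⟨ht₁, le_rfl⟩, i, hi, j, hj, hlt.le⟩
  have ht₀ : t₀ ∉ A := by
    rintro ⟨i, hi, j, hj, hle⟩
    exact hj ((hb j).1 (hle.trans ((hb i).2 hi)))
  refine ⟨t₀, t, lt_of_le_of_ne htI.1 fun e => ht₀ (e ▸ htA), ?_, htA⟩
  intro u hu i hi j hj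
  by_contra! hle
  exact (hmin ⟨⟨hu.1, hu.2.le.trans htI.2⟩, i, hi, j, hj, hle⟩).not_gt hu.2

theorem exists_isTransition {n : ℕ} {s : Fin n → Plane × Plane} (hgp : InGeneralPosition s)
    (hs : ShatteredByHalfplanes (fun i => segment ℝ (s i).1 (s i).2)) {T : Set (Fin n)}
    (hT : T.Nonempty) (hT' : Tᶜ.Nonempty) : ∃ x y t, IsTransition s T x y t := by
  obtain ⟨t₀, t, ht, hlt, i, hi, j, hj, hji⟩ := exists_last_angle hs hT hT'
  have hle : ∀ k ∈ T, ∀ l ∉ T, supportVal s k t ≤ supportVal s l t := by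
    intro k hk l hl
    have hmem : t ∈ closure (Set.Ico t₀ t) := by
      rw [closure_Ico ht.ne]
      exact Set.right_mem_Icc.2 ht.le
    exact closure_minimal (fun u hu => (hlt u hu k hk l hl).le)
      (isClosed_le (continuous_supportVal s k) (continuous_supportVal s l)) hmem
  obtain ⟨x, rfl, hx⟩ := exists_supportVal_eq s i t
  obtain ⟨y, rfl, hy⟩ := exists_supportVal_eq s j t
  have hxy : x.1 ≠ y.1 := ne_of_mem_of_not_mem hi hj
  have hxy' : x ≠ y := fun e => hxy (congrArg _ e)
  have heq : dirVal (endpointOf s x) t = dirVal (endpointOf s y) t := by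
    rw [← hx, ← hy]
    exact (hle _ hi _ hj).antisymm hji
  have hflip : ∀ z w : Fin n × Bool, z.1 ≠ w.1 →
      dirVal (endpointOf s z) t = dirVal (endpointOf s w) t →
      supportVal s z.1 t = dirVal (endpointOf s z) t →
      dirVal (endpointOf s (z.1, !z.2)) t < dirVal (endpointOf s z) t := by
    intro z w hzw h hz
    refine lt_of_le_of_ne (hz ▸ dirVal_le_supportVal s (z.1, !z.2) t) (Ne.symm ?_)
    exact hgp.dirVal_ne (fun e => hzw (congrArg _ e)) (ne_mk_fst_not_snd z)
      (fun e => hzw (congrArg Prod.fst e).symm) h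
  refine ⟨x, y, t, hi, hj, heq, hflip x y hxy heq hx, hflip y x hxy.symm heq.symm hy,
    ?_, ?_, ?_⟩
  · intro k hk hkx
    obtain ⟨z, rfl, hz⟩ := exists_supportVal_eq s k t
    refine lt_of_le_of_ne (heq ▸ hy ▸ hle _ hk _ hj) ?_
    rw [hz]
    exact (hgp.dirVal_ne hxy' (fun e => hkx (congrArg _ e.symm))
      (fun e => hj (e ▸ hk)) heq).symm
  · intro k hk
    exact hx ▸ hle _ hi _ hk
  · have hnear : ∀ᶠ u in nhdsWithin t (Set.Iio t),
        dirVal (endpointOf s (y.1, !y.2)) u < dirVal (endpointOf s y) u :=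
      nhdsWithin_le_nhds ((continuous_dirVal _).continuousAt.eventually_lt
        (continuous_dirVal _).continuousAt (hflip y x hxy.symm heq.symm hy))
    have hIoo : ∀ᶠ u in nhdsWithin t (Set.Iio t), u ∈ Set.Ioo (max t₀ (t - Real.pi)) t :=
      Ioo_mem_nhdsLT (max_lt ht (by linarith [Real.pi_pos]))
    obtain ⟨u, hu, hu₀, hut⟩ := (hnear.and hIoo).exists
    obtain ⟨h₀, hpi⟩ := max_lt_iff.1 hu₀
    refine dirDeriv_lt_of_dirVal_lt hut (by linarith) heq ?_
    have h := hlt u ⟨h₀.le, hut⟩ _ hi _ hj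
    rw [supportVal_eq_max_not s y, max_eq_left hu.le] at h
    exact (dirVal_le_supportVal s x u).trans_lt h

/-- Unordered pairs of endpoints of different segments, listed by increasing segment index. -/
def crossPairs (n : ℕ) : Finset ((Fin n × Bool) × (Fin n × Bool)) :=
  Finset.univ.filter fun q => q.1.1 < q.2.1

/-- No family of six segments in the plane in general position is shattered by
halfplanes. -/
theorem no_six_segments_general_position_shattered (s : Fin 6 → Plane × Plane)
    (hgp : InGeneralPosition s) :
    ¬ ShatteredByHalfplanes (fun i => segment ℝ (s i).1 (s i).2) := by
  intro hs
  have key : ∀ T : Finset (Fin 6), T ∈ ({∅, Finset.univ} : Finset (Finset (Fin 6)))ᶜ →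
      ∃ q ∈ crossPairs 6, ∃ t, IsTransition s T q.1 q.2 t ∨ IsTransition s T q.2 q.1 t := by
    intro T hT
    simp only [Finset.mem_compl, Finset.mem_insert, Finset.mem_singleton, not_or] at hT
    obtain ⟨x, y, t, h⟩ := exists_isTransition hgp hs (T := (T : Set (Fin 6)))
      (Finset.coe_nonempty.2 (Finset.nonempty_iff_ne_empty.2 hT.1))
      (by simpa [Set.nonempty_compl] using hT.2)
    rcases lt_or_gt_of_ne (ne_of_mem_of_not_mem h.mem h.notMem) with hlt | hlt
    · exact ⟨(x, y), by simpa [crossPairs] using hlt, t, Or.inl h⟩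
    · exact ⟨(y, x), by simpa [crossPairs] using hlt, t, Or.inr h⟩
  choose! f hf ht using key
  have hcard : (crossPairs 6).card < ({∅, Finset.univ} : Finset (Finset (Fin 6)))ᶜ.card := by
    rw [Finset.card_compl, show (crossPairs 6).card = 60 by decide]
    simp [Finset.univ_nonempty.ne_empty.symm]
  obtain ⟨T, hT, T', hT', hne, heq⟩ := Finset.exists_ne_map_eq_of_card_lt_of_maps_to
    (s := ({∅, Finset.univ} : Finset (Finset (Fin 6)))ᶜ) (t := crossPairs 6)
    hcard hf
  obtain ⟨t, h⟩ := ht T hT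
  obtain ⟨u, h'⟩ := ht T' hT'
  rw [← heq] at h'
  apply hne
  rw [← Finset.coe_inj]
  rcases h with h | h <;> rcases h' with h' | h'
  · exact h.eq h'
  · exact (h.not_swap h').elim
  · exact (h.not_swap h').elim
  · exact h.eq h'
end
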